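/- arXiv:2405.06824 — 2 statements merged into one kernel-verified Lean document; each statement's English description precedes it below -/
import Mathlib

section
/- (Theorem 1, first part.) Suppose the saddle point problem min_{x∈X} max_{y∈Y} ⟨Kx, y⟩ + g(x) + h(x) − f*(y) has a saddle point, and let (x^k, y^k)_{k∈ℕ} be generated by Algorithm 1 with constant ratio β_k ≡ β > 0, δ ∈ (0,1), step sizes satisfying σ ≤ σ_k ≤ √(1+θ_{k−1})σ_{k−1} for some σ > 0, where θ_k = σ_k/σ_{k−1} and τ_k = βσ_k, and metrics (M_k)_{k∈ℕ} satisfying Assumption 1. Then the sequence (x^k, y^k)_{k∈ℕ} is bounded and every cluster point of (x^k, y^k)_{k∈ℕ} is a saddle point of the problem. -/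
open scoped RealInnerProductSpace
open Filter Topology

/-- Convexity for extended-real-valued functions. -/
def ERealConvexOn {X : Type*} [AddCommGroup X] [Module ℝ X] (g : X → EReal) : Prop :=
  ∀ ⦃u v : X⦄ ⦃a b : ℝ⦄, 0 ≤ a → 0 ≤ b → a + b = 1 →
    g (a • u + b • v) ≤ (a : EReal) * g u + (b : EReal) * g v

/-- `p = prox^Q_{τg}(w)`: `p` minimizes `z ↦ g(z) + (1/(2τ))‖z − w‖²_Q`. -/
def IsProxPt {E : Type*} [NormedAddCommGroup E] [InnerProductSpace ℝ E]
    (Q : E →L[ℝ] E) (τ : ℝ) (g : E → EReal) (w p : E) : Prop :=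
  ∀ z : E,
    g p + ((1 / (2 * τ) * ⟪Q (p - w), p - w⟫ : ℝ) : EReal)
      ≤ g z + ((1 / (2 * τ) * ⟪Q (z - w), z - w⟫ : ℝ) : EReal)

/-- The value `⟨Kx, y⟩ + g(x) + h(x) − f*(y)` of the saddle-point problem. -/
noncomputable def saddleVal {X Y : Type*}
    [NormedAddCommGroup X] [InnerProductSpace ℝ X]
    [NormedAddCommGroup Y] [InnerProductSpace ℝ Y]
    (K : X →L[ℝ] Y) (g : X → EReal) (h : X → ℝ) (fs : Y → EReal)
    (x : X) (y : Y) : EReal :=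
  ((⟪K x, y⟫ : ℝ) : EReal) + g x + ((h x : ℝ) : EReal) - fs y

/-- `(xh, yh)` is a saddle point. -/
def IsSaddlePoint {X Y : Type*}
    [NormedAddCommGroup X] [InnerProductSpace ℝ X]
    [NormedAddCommGroup Y] [InnerProductSpace ℝ Y]
    (K : X →L[ℝ] Y) (g : X → EReal) (h : X → ℝ) (fs : Y → EReal)
    (xh : X) (yh : Y) : Prop :=
  ∀ (x : X) (y : Y),
    saddleVal K g h fs xh y ≤ saddleVal K g h fs xh yh ∧
    saddleVal K g h fs xh yh ≤ saddleVal K g h fs x yh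

/-- A quadratic perturbation vanishing at `0` does not affect a linear inequality. -/
theorem le_of_forall_le_add_mul {a b c : ℝ}
    (hab : ∀ t : ℝ, 0 < t → t ≤ 1 → a ≤ b + t * c) : a ≤ b := by
  have ht : Tendsto (fun t : ℝ => b + t * c) (𝓝[>] 0) (𝓝 b) := by
    have h0 : Tendsto (fun t : ℝ => b + t * c) (𝓝 0) (𝓝 (b + 0 * c)) :=
      Continuous.tendsto (by fun_prop) 0
    rw [zero_mul, add_zero] at h0
    exact h0.mono_left nhdsWithin_le_nhds
  refine ge_of_tendsto ht ?_
  filter_upwards [Ioc_mem_nhdsGT (zero_lt_one' ℝ)] with t ht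
  exact hab t ht.1 ht.2

/-- The variational inequality characterizing a proximal point. -/
theorem IsProxPt.ne_top_and_le {E : Type*} [NormedAddCommGroup E] [InnerProductSpace ℝ E]
    {Q : E →L[ℝ] E} {τ : ℝ} {g : E → EReal} {w p : E}
    (hp : IsProxPt Q τ g w p) (hτ : 0 < τ) (hQ : ∀ u v : E, ⟪Q u, v⟫ = ⟪u, Q v⟫)
    (hbot : ∀ z, g z ≠ ⊥) (htop : ∃ z, g z ≠ ⊤) (hconv : ERealConvexOn g) :
    g p ≠ ⊤ ∧ ∀ z, g z ≠ ⊤ → τ * ((g p).toReal - (g z).toReal) ≤ ⟪Q (p - w), z - p⟫ := by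
  have hpt : g p ≠ ⊤ := by
    obtain ⟨z, hz⟩ := htop
    intro hp'
    have h1 := hp z
    rw [hp', EReal.top_add_coe, top_le_iff, ← EReal.coe_toReal hz (hbot z), ← EReal.coe_add] at h1
    exact EReal.coe_ne_top _ h1
  refine ⟨hpt, fun z hz => ?_⟩
  have hgp := EReal.coe_toReal hpt (hbot p)
  have hgz := EReal.coe_toReal hz (hbot z)
  set a := (g p).toReal
  set b := (g z).toReal
  refine le_of_forall_le_add_mul (c := ⟪Q (z - p), z - p⟫ / 2) fun t ht0 ht1 => ?_
  have hc := hconv (u := p) (v := z) (sub_nonneg.2 ht1) ht0.le (by ring)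
  have hq := (hp ((1 - t) • p + t • z)).trans (add_le_add_left hc _)
  rw [← hgp, ← hgz] at hq
  have hr : a + 1 / (2 * τ) * ⟪Q (p - w), p - w⟫ ≤ (1 - t) * a + t * b + 1 / (2 * τ) *
      ⟪Q ((1 - t) • p + t • z - w), (1 - t) • p + t • z - w⟫ := by exact_mod_cast hq
  have hd : (1 - t) • p + t • z - w = (p - w) + t • (z - p) := by module
  have hsym : ⟪Q (z - p), p - w⟫ = ⟪Q (p - w), z - p⟫ := by
    rw [hQ, real_inner_comm]
  rw [hd] at hr
  simp only [map_add, map_smul, inner_add_left, inner_add_right, real_inner_smul_left,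
    real_inner_smul_right, hsym] at hr
  have hr' : t * (a - b) ≤
      1 / (2 * τ) * (t * (2 * ⟪Q (p - w), z - p⟫ + t * ⟪Q (z - p), z - p⟫)) := by
    linarith
  rw [one_div, inv_mul_eq_div, le_div_iff₀ (by positivity)] at hr'
  have hr'' : t * (τ * (a - b)) ≤
      t * (⟪Q (p - w), z - p⟫ + t * (⟪Q (z - p), z - p⟫ / 2)) := by linarith
  exact le_of_mul_le_mul_left hr'' ht0

/-- The gradient inequality for a differentiable convex function. -/
theorem ConvexOn.add_inner_gradient_le {X : Type*} [NormedAddCommGroup X]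
    [InnerProductSpace ℝ X] [CompleteSpace X] {h : X → ℝ} {u v d : X}
    (hconv : ConvexOn ℝ Set.univ h) (hd : HasGradientAt h d u) :
    h u + ⟪d, v - u⟫ ≤ h v := by
  have hφ : ConvexOn ℝ Set.univ (fun t : ℝ => h (AffineMap.lineMap u v t)) :=
    hconv.comp_affineMap (AffineMap.lineMap u v)
  have hl : HasDerivAt (fun t : ℝ => (AffineMap.lineMap u v : ℝ → X) t) (v - u) 0 :=
    AffineMap.hasDerivAt_lineMap
  have hd' : HasFDerivAt h (InnerProductSpace.toDual ℝ X d)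
      ((AffineMap.lineMap u v : ℝ → X) 0) := by
    simpa using hd.hasFDerivAt
  have h1 := hφ.le_slope_of_hasDerivAt (Set.mem_univ 0) (Set.mem_univ 1) zero_lt_one
    (hd'.comp_hasDerivAt 0 hl)
  simp [slope_def_field] at h1
  linarith

/-- A bound `f (u n) ≤ r n` passes to the limit for lower semicontinuous `f`. -/
theorem LowerSemicontinuous.le_of_tendsto {E : Type*} [TopologicalSpace E] {f : E → EReal}
    (hf : LowerSemicontinuous f) {u : ℕ → E} {a : E} {r : ℕ → ℝ} {s : ℝ}
    (hu : Tendsto u atTop (𝓝 a)) (hr : Tendsto r atTop (𝓝 s))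
    (hle : ∀ᶠ n in atTop, f (u n) ≤ (r n : EReal)) : f a ≤ (s : EReal) :=
  hf.isClosed_epigraph.mem_of_tendsto
    (hu.prodMk_nhds ((continuous_coe_real_ereal.tendsto s).comp hr)) hle

/-- Saddle points in terms of real-valued optimality conditions. -/
theorem isSaddlePoint_iff {X Y : Type*}
    [NormedAddCommGroup X] [InnerProductSpace ℝ X]
    [NormedAddCommGroup Y] [InnerProductSpace ℝ Y]
    {K : X →L[ℝ] Y} {g : X → EReal} {h : X → ℝ} {fs : Y → EReal}
    (hgbot : ∀ z, g z ≠ ⊥) (hgtop : ∃ z, g z ≠ ⊤)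
    (hfbot : ∀ z, fs z ≠ ⊥) (hftop : ∃ z, fs z ≠ ⊤) {xh : X} {yh : Y} :
    IsSaddlePoint K g h fs xh yh ↔ g xh ≠ ⊤ ∧ fs yh ≠ ⊤ ∧
      (∀ z, g z ≠ ⊤ →
        (g xh).toReal + h xh + ⟪K xh, yh⟫ ≤ (g z).toReal + h z + ⟪K z, yh⟫) ∧
      ∀ v, fs v ≠ ⊤ → (fs yh).toReal - ⟪K xh, yh⟫ ≤ (fs v).toReal - ⟪K xh, v⟫ := by
  have key : ∀ z v, g z ≠ ⊤ → fs v ≠ ⊤ → saddleVal K g h fs z v =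
      ((⟪K z, v⟫ + (g z).toReal + h z - (fs v).toReal : ℝ) : EReal) := by
    intro z v hz hv
    unfold saddleVal
    rw [← EReal.coe_toReal hz (hgbot z), ← EReal.coe_toReal hv (hfbot v)]
    simp
  have keyf : ∀ z v, fs v = ⊤ → saddleVal K g h fs z v = ⊥ := by
    intro z v hv
    unfold saddleVal
    rw [hv, EReal.sub_top]
  have keyg : ∀ z v, g z = ⊤ → fs v ≠ ⊤ → saddleVal K g h fs z v = ⊤ := by
    intro z v hz hv
    unfold saddleVal
    rw [hz, ← EReal.coe_toReal hv (hfbot v)]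
    simp
  obtain ⟨z₀, hz₀⟩ := hgtop
  obtain ⟨v₀, hv₀⟩ := hftop
  constructor
  · intro hs
    have hfy : fs yh ≠ ⊤ := by
      intro hf
      have h1 := (hs z₀ v₀).1
      rw [keyf xh yh hf, le_bot_iff] at h1
      by_cases hg : g xh = ⊤
      · rw [keyg xh v₀ hg hv₀] at h1
        exact top_ne_bot h1
      · rw [key xh v₀ hg hv₀] at h1
        exact EReal.coe_ne_bot _ h1
    have hgx : g xh ≠ ⊤ := by
      intro hg
      have h1 := (hs z₀ v₀).2
      rw [keyg xh yh hg hfy, key z₀ yh hz₀ hfy, top_le_iff] at h1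
      exact EReal.coe_ne_top _ h1
    refine ⟨hgx, hfy, fun z hz => ?_, fun v hv => ?_⟩
    · have h1 := (hs z v₀).2
      rw [key _ _ hgx hfy, key _ _ hz hfy, EReal.coe_le_coe_iff] at h1
      linarith
    · have h1 := (hs z₀ v).1
      rw [key _ _ hgx hfy, key _ _ hgx hv, EReal.coe_le_coe_iff] at h1
      linarith
  · rintro ⟨hgx, hfy, h1, h2⟩ z v
    constructor
    · by_cases hv : fs v = ⊤
      · rw [keyf _ _ hv]
        exact bot_le
      · rw [key _ _ hgx hfy, key _ _ hgx hv, EReal.coe_le_coe_iff]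
        linarith [h2 v hv]
    · by_cases hz : g z = ⊤
      · rw [keyg _ _ hz hfy]
        exact le_top
      · rw [key _ _ hgx hfy, key _ _ hz hfy, EReal.coe_le_coe_iff]
        linarith [h1 z hz]

/-- A deterministic Robbins–Siegmund lemma. -/
theorem exists_bound_and_tendsto_zero_of_quasi_decreasing {e r η : ℕ → ℝ}
    (he : ∀ n, 0 ≤ e n) (hr : ∀ n, 0 ≤ r n) (hη : ∀ n, 0 ≤ η n) (hs : Summable η)
    (hle : ∀ n, e (n + 1) + r n ≤ (1 + η n) * e n) :
    (∃ C, ∀ n, e n ≤ C) ∧ Tendsto r atTop (𝓝 0) := by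
  have hbound : ∀ n, e n ≤ e 0 * Real.exp (∑ i ∈ Finset.range n, η i) := by
    intro n
    induction n with
    | zero => simp
    | succ n ih =>
      rw [Finset.sum_range_succ, Real.exp_add]
      calc e (n + 1) ≤ (η n + 1) * e n := by linarith [hle n, hr n]
        _ ≤ Real.exp (η n) * (e 0 * Real.exp (∑ i ∈ Finset.range n, η i)) :=
          mul_le_mul (Real.add_one_le_exp _) ih (he n) (Real.exp_pos _).le
        _ = _ := by ring
  have hsum : ∀ n, ∑ i ∈ Finset.range n, η i ≤ ∑' i, η i :=
    fun n => hs.sum_le_tsum _ fun i _ => hη i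
  set C := e 0 * Real.exp (∑' i, η i)
  have hC : ∀ n, e n ≤ C := fun n => (hbound n).trans
    (mul_le_mul_of_nonneg_left (Real.exp_le_exp.2 (hsum n)) (he 0))
  have hC0 : 0 ≤ C := (he 0).trans (hC 0)
  refine ⟨⟨C, hC⟩, ?_⟩
  have htel : ∀ n, e n + ∑ i ∈ Finset.range n, r i ≤
      e 0 + (∑ i ∈ Finset.range n, η i) * C := by
    intro n
    induction n with
    | zero => simp
    | succ n ih =>
      rw [Finset.sum_range_succ, Finset.sum_range_succ]
      have := mul_le_mul_of_nonneg_left (hC n) (hη n)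
      linarith [hle n]
  have hrs : Summable r := summable_of_sum_range_le (c := e 0 + (∑' i, η i) * C) hr fun n => by
    have := mul_le_mul_of_nonneg_right (hsum n) hC0
    linarith [htel n, he n]
  exact hrs.tendsto_atTop_zero

/-- The three-point identity for a self-adjoint form. -/
theorem two_mul_inner_sub_sub {E : Type*} [NormedAddCommGroup E] [InnerProductSpace ℝ E]
    (Q : E →L[ℝ] E) (hQ : ∀ u v : E, ⟪Q u, v⟫ = ⟪u, Q v⟫) (a b c : E) :
    2 * ⟪Q (a - b), c - a⟫ =
      ⟪Q (b - c), b - c⟫ - ⟪Q (a - c), a - c⟫ - ⟪Q (a - b), a - b⟫ := by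
  have hs : ∀ u v : E, ⟪Q u, v⟫ = ⟪Q v, u⟫ := fun u v => by rw [hQ, real_inner_comm]
  simp only [map_sub, inner_sub_left, inner_sub_right]
  linarith [hs a b, hs a c, hs b c]

/-- One-iteration energy estimate. The scalars `ga`, `gh`, `fa`, … stand for the values of `g` and
`f*` at the points in play, and `D` for the Bregman distance of `h` between consecutive iterates. -/
theorem primal_dual_energy_estimate {X Y : Type*} [NormedAddCommGroup X] [InnerProductSpace ℝ X]
    [NormedAddCommGroup Y] [InnerProductSpace ℝ Y] (K : X →L[ℝ] Y) (Q : X →L[ℝ] X)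
    (hQ : ∀ u v : X, ⟪Q u, v⟫ = ⟪u, Q v⟫) {β σ θ δ : ℝ} (hβ : 0 < β) (hσ : 0 < σ)
    {x xn xh d : X} {y₀ y yn yh yb : Y} {gn gh hx hn hh f₀ f fn fh : ℝ}
    (hyb : yb = y + θ • (y - y₀))
    (hprimal : β * σ * (gn - gh) ≤ ⟪Q (xn - x), xh - xn⟫
      + β * σ * ⟪K (xh - xn), yb⟫ + β * σ * ⟪d, xh - xn⟫)
    (hdual : σ * (fn - fh) ≤ ⟪yn - y, yh - yn⟫ - σ * ⟪K xn, yh - yn⟫)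
    (hextra : σ * ((1 + θ) * f - fn - θ * f₀) ≤ ⟪yb - y, yn - yb⟫ - σ * ⟪K x, yn - yb⟫)
    (hgrad : hx + ⟪d, xh - x⟫ ≤ hh)
    (hls : (β * σ) * σ * ‖K xn - K x‖ ^ 2 + 2 * (β * σ) * (hn - hx - ⟪d, xn - x⟫)
      ≤ δ * ⟪Q (xn - x), xn - x⟫) :
    ⟪Q (xn - xh), xn - xh⟫ + (1 - δ) * ⟪Q (xn - x), xn - x⟫
        + β * (‖yn - yh‖ ^ 2 + ‖yb - y‖ ^ 2)
        + 2 * β * σ * (gn + hn - gh - hh + ⟪K (xn - xh), yh⟫)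
        + 2 * β * σ * (1 + θ) * (f - fh - ⟪K xh, y - yh⟫)
      ≤ ⟪Q (x - xh), x - xh⟫ + β * ‖y - yh‖ ^ 2
        + 2 * β * σ * θ * (f₀ - fh - ⟪K xh, y₀ - yh⟫) := by
  have hx3 := two_mul_inner_sub_sub Q hQ xn x xh
  have hy3 := two_mul_inner_sub_sub (1 : Y →L[ℝ] Y) (fun _ _ => rfl) yn y yh
  have hb3 := two_mul_inner_sub_sub (1 : Y →L[ℝ] Y) (fun _ _ => rfl) yb y yn
  simp only [one_apply_eq_self, real_inner_self_eq_norm_sq] at hy3 hb3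
  rw [norm_sub_rev y yn] at hb3
  have hyoung : 2 * (σ * ⟪K (xn - x), yn - yb⟫) ≤ σ ^ 2 * ‖K xn - K x‖ ^ 2 + ‖yb - yn‖ ^ 2 := by
    have h1 := mul_le_mul_of_nonneg_left (real_inner_le_norm (K (xn - x)) (yn - yb)) hσ.le
    have h2 := two_mul_le_add_sq (σ * ‖K (xn - x)‖) ‖yn - yb‖
    rw [map_sub] at *
    rw [norm_sub_rev yb yn]
    linarith
  have hbil : ⟪K (xh - xn), yb⟫ - ⟪K xn, yh - yn⟫ - ⟪K x, yn - yb⟫ =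
      ⟪K (xn - x), yn - yb⟫ - ⟪K (xn - xh), yh⟫ - (1 + θ) * -⟪K xh, y - yh⟫
        + θ * -⟪K xh, y₀ - yh⟫ := by
    rw [hyb]
    simp only [map_sub, inner_sub_left, inner_sub_right, inner_add_right, real_inner_smul_right]
    ring
  have hd : ⟪d, xh - xn⟫ = ⟪d, xh - x⟫ - ⟪d, xn - x⟫ := by
    rw [← inner_sub_right]; congr 1; abel
  have hβσ : 0 < β * σ := mul_pos hβ hσ
  have hβ' := hβ.le
  linear_combination 2 * hprimal + (2 * β) * hdual + (2 * β) * hextra + (2 * β * σ) * hgrad + hls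
    + β * hyoung + hx3 + β * hy3 + β * hb3 + (2 * β * σ) * hbil + (2 * β * σ) * hd

theorem EReal.ne_top_and_toReal_le {a : EReal} {s : ℝ} (ha : a ≠ ⊥) (h : a ≤ (s : EReal)) :
    a ≠ ⊤ ∧ a.toReal ≤ s :=
  ⟨ne_top_of_le_ne_top (EReal.coe_ne_top s) h, by
    simpa using EReal.toReal_le_toReal h ha (EReal.coe_ne_top s)⟩

theorem tendsto_zero_of_mul_norm_sq_le {E : Type*} [NormedAddCommGroup E] {u : ℕ → E}
    {r : ℕ → ℝ} {c : ℝ} (hc : 0 < c) (hr : Tendsto r atTop (𝓝 0))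
    (hle : ∀ n, c * ‖u n‖ ^ 2 ≤ r n) : Tendsto u atTop (𝓝 0) := by
  refine squeeze_zero_norm (a := fun n => Real.sqrt (c⁻¹ * r n)) (fun n => ?_) ?_
  · refine Real.le_sqrt_of_sq_le ?_
    rw [inv_mul_eq_div, le_div_iff₀ hc]
    linarith [hle n]
  · simpa using (hr.const_mul c⁻¹).sqrt

/-- A sequence tending to zero still does after scaling by bounded factors and applying
uniformly bounded operators. -/
theorem tendsto_zero_inv_smul_apply {E : Type*} [NormedAddCommGroup E] [NormedSpace ℝ E]
    {T : ℕ → E →L[ℝ] E} {u : ℕ → E} {s : ℕ → ℝ} {b C : ℝ} (hb : 0 < b) (hs : ∀ n, b ≤ s n)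
    (hT : ∀ n, ‖T n‖ ≤ C) (hu : Tendsto u atTop (𝓝 0)) :
    Tendsto (fun n => (s n)⁻¹ • T n (u n)) atTop (𝓝 0) := by
  refine squeeze_zero_norm (a := fun n => b⁻¹ * (C * ‖u n‖)) (fun n => ?_) ?_
  · rw [norm_smul, norm_inv, Real.norm_of_nonneg (hb.le.trans (hs n))]
    exact mul_le_mul (inv_anti₀ hb (hs n)) ((T n).le_of_opNorm_le (hT n) _) (norm_nonneg _)
      (inv_nonneg.2 hb.le)
  · simpa using (hu.norm.const_mul C).const_mul b⁻¹

/-- **Theorem 1, first part.** If the saddle-point problem has a saddle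
point, then the sequence `(x^k, y^k)` generated by Algorithm 1 (constant ratio
`β_k ≡ β`, `δ ∈ (0,1)`, `σ ≤ σ_k ≤ √(1+θ_{k−1})σ_{k−1}`, metrics satisfying
Assumption 1) is bounded and every cluster point is a saddle point. -/
theorem algorithm_bounded_and_cluster_points_are_saddle
    {X Y : Type*} [NormedAddCommGroup X] [InnerProductSpace ℝ X] [FiniteDimensional ℝ X]
    [NormedAddCommGroup Y] [InnerProductSpace ℝ Y] [FiniteDimensional ℝ Y]
    (K : X →L[ℝ] Y)
    (g : X → EReal)
    (hgbot : ∀ z : X, g z ≠ ⊥) (hgtop : ∃ z : X, g z ≠ ⊤)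
    (hglsc : LowerSemicontinuous g) (hgconv : ERealConvexOn g)
    (fs : Y → EReal)
    (hfbot : ∀ z : Y, fs z ≠ ⊥) (hftop : ∃ z : Y, fs z ≠ ⊤)
    (hflsc : LowerSemicontinuous fs) (hfconv : ERealConvexOn fs)
    (h : X → ℝ) (h' : X → X) (L : ℝ)
    (hhconv : ConvexOn ℝ Set.univ h)
    (hgrad : ∀ z : X, HasGradientAt h (h' z) z)
    (hLip : ∀ u v : X, ‖h' u - h' v‖ ≤ L * ‖u - v‖)
    -- Assumption 1 on the metrics
    (α C_M : ℝ) (hα : 0 < α)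
    (M Minv : ℕ → X →L[ℝ] X) (η : ℕ → ℝ)
    (hMsa : ∀ k, ∀ u v : X, ⟪M k u, v⟫ = ⟪u, M k v⟫)
    (hMα : ∀ k, ∀ z : X, α * ‖z‖ ^ 2 ≤ ⟪M k z, z⟫)
    (hMC : ∀ k, ‖M k‖ ≤ C_M)
    (hηnn : ∀ k, 0 ≤ η k) (hηsum : Summable η)
    (hMmono : ∀ k, ∀ z : X, ⟪M (k + 1) z, z⟫ ≤ (1 + η k) * ⟪M k z, z⟫)
    (hMinv1 : ∀ k, (M k).comp (Minv k) = ContinuousLinearMap.id ℝ X)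
    (hMinv2 : ∀ k, (Minv k).comp (M k) = ContinuousLinearMap.id ℝ X)
    -- step sizes
    (β δ σlb : ℝ) (hβ : 0 < β) (hδ : δ ∈ Set.Ioo (0 : ℝ) 1) (hσlb : 0 < σlb)
    (σ θ : ℕ → ℝ)
    (hσpos : ∀ k, 0 < σ k) (hσlbk : ∀ k, σlb ≤ σ k)
    (hθ0 : 0 ≤ θ 0)
    (hθ : ∀ k, 1 ≤ k → θ k = σ k / σ (k - 1))
    (hσub : ∀ k, 1 ≤ k → σ k ≤ Real.sqrt (1 + θ (k - 1)) * σ (k - 1))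
    -- the iterates of Algorithm 1
    (x : ℕ → X) (y : ℕ → Y) (ybar : ℕ → Y)
    (hy : ∀ k, 1 ≤ k →
      IsProxPt (1 : Y →L[ℝ] Y) (σ (k - 1)) fs (y (k - 1) + σ (k - 1) • K (x k)) (y k))
    (hybar : ∀ k, 1 ≤ k → ybar k = y k + θ k • (y k - y (k - 1)))
    (hx : ∀ k, 1 ≤ k →
      IsProxPt (M k) (β * σ k) g
        (x k - (β * σ k) • (Minv k) ((ContinuousLinearMap.adjoint K) (ybar k))
          - (β * σ k) • (Minv k) (h' (x k)))
        (x (k + 1)))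
    (hls : ∀ k, 1 ≤ k →
      (β * σ k) * σ k * ‖K (x (k + 1)) - K (x k)‖ ^ 2
          + 2 * (β * σ k) * (h (x (k + 1)) - h (x k) - ⟪h' (x k), x (k + 1) - x k⟫)
        ≤ δ * ⟪(M k) (x (k + 1) - x k), x (k + 1) - x k⟫)
    -- existence of a saddle point
    (hexists : ∃ p : X × Y, IsSaddlePoint K g h fs p.1 p.2) :
    (∃ C : ℝ, ∀ k, ‖x k‖ ≤ C ∧ ‖y k‖ ≤ C) ∧
    ∀ p : X × Y, MapClusterPt p atTop (fun k => (x k, y k)) →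
      IsSaddlePoint K g h fs p.1 p.2 := by
  have hfprox : ∀ n, fs (y (n + 1)) ≠ ⊤ ∧ ∀ v, fs v ≠ ⊤ →
      σ n * ((fs (y (n + 1))).toReal - (fs v).toReal) ≤
        ⟪y (n + 1) - y n, v - y (n + 1)⟫ - σ n * ⟪K (x (n + 1)), v - y (n + 1)⟫ := by
    intro n
    have hp := (hy (n + 1) (by omega)).ne_top_and_le (hσpos _) (fun _ _ => rfl) hfbot hftop hfconv
    refine ⟨hp.1, fun v hv => (hp.2 v hv).trans_eq ?_⟩
    simp only [Nat.add_sub_cancel, one_apply_eq_self, ← sub_sub]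
    rw [inner_sub_left, real_inner_smul_left]
  have hgprox : ∀ k, 1 ≤ k → g (x (k + 1)) ≠ ⊤ ∧ ∀ z, g z ≠ ⊤ →
      β * σ k * ((g (x (k + 1))).toReal - (g z).toReal) ≤
        ⟪M k (x (k + 1) - x k), z - x (k + 1)⟫ + β * σ k * ⟪K (z - x (k + 1)), ybar k⟫
          + β * σ k * ⟪h' (x k), z - x (k + 1)⟫ := by
    intro k hk
    have hp := (hx k hk).ne_top_and_le (mul_pos hβ (hσpos k)) (hMsa k) hgbot hgtop hgconv
    refine ⟨hp.1, fun z hz => (hp.2 z hz).trans_eq ?_⟩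
    have hMM : ∀ u, M k (Minv k u) = u := fun u => by
      simpa using congrArg (fun T : X →L[ℝ] X => T u) (hMinv1 k)
    have hw : M k (x (k + 1) - (x k - (β * σ k) • Minv k (ContinuousLinearMap.adjoint K (ybar k))
        - (β * σ k) • Minv k (h' (x k)))) = M k (x (k + 1) - x k)
          + (β * σ k) • ContinuousLinearMap.adjoint K (ybar k) + (β * σ k) • h' (x k) := by
      simp only [map_sub, map_smul, hMM]
      abel
    rw [hw, inner_add_left, inner_add_left, real_inner_smul_left, real_inner_smul_left,
      ContinuousLinearMap.adjoint_inner_left, real_inner_comm (K _)]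
  have hθσ : ∀ n, σ (n + 1) = θ (n + 1) * σ n := by
    intro n
    rw [hθ (n + 1) (by omega), Nat.add_sub_cancel, div_mul_cancel₀ _ (hσpos n).ne']
  have hθnn : ∀ n, 0 ≤ θ n := by
    rintro (_ | n)
    · exact hθ0
    · rw [hθ (n + 1) (by omega)]
      exact (div_pos (hσpos _) (hσpos _)).le
  have hθsq : ∀ n, θ (n + 1) ^ 2 ≤ 1 + θ n := by
    intro n
    have h1 := hσub (n + 1) (by omega)
    rw [Nat.add_sub_cancel, hθσ n] at h1
    exact (Real.le_sqrt (hθnn _) (by linarith [hθnn n])).1 (le_of_mul_le_mul_right h1 (hσpos n))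
  obtain ⟨⟨xh, yh⟩, hsaddle⟩ := hexists
  obtain ⟨hgxh, hfyh, hPopt, hDopt⟩ := (isSaddlePoint_iff hgbot hgtop hfbot hftop).1 hsaddle
  dsimp only at hgxh hfyh hPopt hDopt
  set gap : ℕ → ℝ := fun n => (fs (y n)).toReal - (fs yh).toReal - ⟪K xh, y n - yh⟫ with hgap
  have hgap0 : ∀ n, 0 ≤ gap (n + 1) := fun n => by
    have := hDopt _ (hfprox n).1
    simp only [hgap, inner_sub_right]
    linarith
  set e : ℕ → ℝ := fun n => ⟪M (n + 2) (x (n + 2) - xh), x (n + 2) - xh⟫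
    + β * ‖y (n + 2) - yh‖ ^ 2 + 2 * β * (σ (n + 1) * (1 + θ (n + 1)) * gap (n + 1)) with he
  set r : ℕ → ℝ := fun n =>
    (1 - δ) * ⟪M (n + 2) (x (n + 3) - x (n + 2)), x (n + 3) - x (n + 2)⟫
      + β * ‖ybar (n + 2) - y (n + 2)‖ ^ 2 with hr
  have hMnn : ∀ k z, 0 ≤ ⟪M k z, z⟫ := fun k z =>
    (mul_nonneg hα.le (sq_nonneg _)).trans (hMα k z)
  have hδ1 : 0 < 1 - δ := sub_pos.2 hδ.2
  have hlast : ∀ n, 0 ≤ 2 * β * (σ (n + 1) * (1 + θ (n + 1)) * gap (n + 1)) := fun n =>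
    mul_nonneg (by positivity) (mul_nonneg (mul_nonneg (hσpos _).le (by linarith [hθnn (n + 1)]))
      (hgap0 n))
  have he0 : ∀ n, 0 ≤ e n := fun n =>
    add_nonneg (add_nonneg (hMnn _ _) (by positivity)) (hlast n)
  have hr0 : ∀ n, 0 ≤ r n := fun n =>
    add_nonneg (mul_nonneg hδ1.le (hMnn _ _)) (by positivity)
  have hstep : ∀ n, e (n + 1) + r n ≤ (1 + η (n + 2)) * e n := by
    intro n
    have hextra : σ (n + 2) * ((1 + θ (n + 2)) * (fs (y (n + 2))).toReal
        - (fs (y (n + 3))).toReal - θ (n + 2) * (fs (y (n + 1))).toReal) ≤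
        ⟪ybar (n + 2) - y (n + 2), y (n + 3) - ybar (n + 2)⟫
          - σ (n + 2) * ⟪K (x (n + 2)), y (n + 3) - ybar (n + 2)⟫ := by
      have h1 := mul_le_mul_of_nonneg_left ((hfprox (n + 1)).2 _ (hfprox (n + 2)).1)
        (hθnn (n + 2))
      have h2 := mul_le_mul_of_nonneg_left ((hfprox (n + 1)).2 _ (hfprox n).1)
        (sq_nonneg (θ (n + 2)))
      have hyb : ybar (n + 2) = y (n + 2) + θ (n + 2) • (y (n + 2) - y (n + 1)) :=
        hybar (n + 2) (by omega)
      have hd1 : ybar (n + 2) - y (n + 2) = θ (n + 2) • (y (n + 2) - y (n + 1)) := by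
        rw [hyb, add_sub_cancel_left]
      have hd2 : y (n + 3) - ybar (n + 2) =
          (y (n + 3) - y (n + 2)) + θ (n + 2) • (y (n + 1) - y (n + 2)) := by
        rw [hyb]; module
      rw [hd1, hd2, inner_add_right, inner_add_right, real_inner_smul_left, real_inner_smul_left,
        real_inner_smul_right, real_inner_smul_right, hθσ (n + 1)]
      simp only [add_assoc, Nat.reduceAdd] at h1 h2 ⊢
      linarith
    have hest := primal_dual_energy_estimate (y₀ := y (n + 1)) K (M (n + 2)) (hMsa _) hβ
      (hσpos (n + 2)) (hybar (n + 2) (by omega)) ((hgprox (n + 2) (by omega)).2 xh hgxh)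
      ((hfprox (n + 2)).2 yh hfyh) hextra
      (hhconv.add_inner_gradient_le (hgrad (x (n + 2))) (v := xh))
      (hls (n + 2) (by omega))
    have hP : 0 ≤ 2 * β * σ (n + 2) * ((g (x (n + 2 + 1))).toReal + h (x (n + 2 + 1))
        - (g xh).toReal - h xh + ⟪K (x (n + 2 + 1) - xh), yh⟫) := by
      have h1 := hPopt _ (hgprox (n + 2) (by omega)).1
      have h2 := hσpos (n + 2)
      refine mul_nonneg (by positivity) ?_
      rw [map_sub, inner_sub_left]
      linarith
    have hθgap : σ (n + 2) * θ (n + 2) * gap (n + 1) ≤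
        σ (n + 1) * (1 + θ (n + 1)) * gap (n + 1) := by
      refine mul_le_mul_of_nonneg_right ?_ (hgap0 n)
      have h1 := mul_le_mul_of_nonneg_left (hθsq (n + 1)) (hσpos (n + 1)).le
      rw [hθσ (n + 1)]
      simp only [add_assoc, Nat.reduceAdd] at h1 ⊢
      linarith
    have hθgap' := mul_le_mul_of_nonneg_left hθgap (show 0 ≤ 2 * β by positivity)
    have hmono := hMmono (n + 2) (x (n + 3) - xh)
    have hone : ⟪M (n + 2) (x (n + 3) - xh), x (n + 3) - xh⟫ + β * ‖y (n + 3) - yh‖ ^ 2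
        + 2 * β * (σ (n + 2) * (1 + θ (n + 2)) * gap (n + 2)) + r n ≤ e n := by
      simp only [he, hr, hgap, add_assoc, Nat.reduceAdd] at hest hP hθgap' ⊢
      linarith
    have hη1 := mul_le_mul_of_nonneg_left hone (show 0 ≤ 1 + η (n + 2) by linarith [hηnn (n + 2)])
    have hη2 : 0 ≤ η (n + 2) * (β * ‖y (n + 3) - yh‖ ^ 2
        + 2 * β * (σ (n + 2) * (1 + θ (n + 2)) * gap (n + 2)) + r n) :=
      mul_nonneg (hηnn _) (add_nonneg (add_nonneg (by positivity) (hlast (n + 1))) (hr0 n))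
    have hesucc : e (n + 1) = ⟪M (n + 3) (x (n + 3) - xh), x (n + 3) - xh⟫
      + β * ‖y (n + 3) - yh‖ ^ 2 + 2 * β * (σ (n + 2) * (1 + θ (n + 2)) * gap (n + 2)) := rfl
    rw [hesucc]
    simp only [add_assoc, Nat.reduceAdd] at hmono hη1 hη2 ⊢
    linarith
  obtain ⟨⟨C, hC⟩, hrlim⟩ := exists_bound_and_tendsto_zero_of_quasi_decreasing he0 hr0
    (fun n => hηnn (n + 2)) ((summable_nat_add_iff 2).2 hηsum) hstep
  have hdx : Tendsto (fun k => x (k + 1) - x k) atTop (𝓝 0) := by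
    rw [← tendsto_add_atTop_iff_nat 2]
    refine tendsto_zero_of_mul_norm_sq_le (c := (1 - δ) * α) (mul_pos hδ1 hα) hrlim fun n => ?_
    have h1 := mul_le_mul_of_nonneg_left (hMα (n + 2) (x (n + 3) - x (n + 2))) hδ1.le
    have h2 : 0 ≤ β * ‖ybar (n + 2) - y (n + 2)‖ ^ 2 := by positivity
    simp only [hr, add_assoc, Nat.reduceAdd] at h1 h2 ⊢
    linarith
  have hdy : Tendsto (fun k => ybar k - y k) atTop (𝓝 0) := by
    rw [← tendsto_add_atTop_iff_nat 2]
    refine tendsto_zero_of_mul_norm_sq_le hβ hrlim fun n => ?_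
    have h1 := mul_nonneg hδ1.le (hMnn (n + 2) (x (n + 3) - x (n + 2)))
    simp only [hr]
    linarith
  constructor
  · have hxb : ∀ n, ‖x (n + 2)‖ ≤ Real.sqrt (C / α) + ‖xh‖ := by
      intro n
      have h1 : ‖x (n + 2) - xh‖ ≤ Real.sqrt (C / α) := by
        refine Real.le_sqrt_of_sq_le ?_
        rw [le_div_iff₀ hα]
        have h2 : 0 ≤ β * ‖y (n + 2) - yh‖ ^ 2 := by positivity
        linarith [hMα (n + 2) (x (n + 2) - xh), hC n, hlast n]
      have h3 := norm_add_le (x (n + 2) - xh) xh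
      rw [sub_add_cancel] at h3
      linarith
    have hyb : ∀ n, ‖y (n + 2)‖ ≤ Real.sqrt (C / β) + ‖yh‖ := by
      intro n
      have h1 : ‖y (n + 2) - yh‖ ≤ Real.sqrt (C / β) := by
        refine Real.le_sqrt_of_sq_le ?_
        rw [le_div_iff₀ hβ]
        linarith [hMnn (n + 2) (x (n + 2) - xh), hC n, hlast n]
      have h3 := norm_add_le (y (n + 2) - yh) yh
      rw [sub_add_cancel] at h3
      linarith
    have hA := Real.sqrt_nonneg (C / α)
    have hB := Real.sqrt_nonneg (C / β)
    refine ⟨Real.sqrt (C / α) + ‖xh‖ + (Real.sqrt (C / β) + ‖yh‖)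
      + ‖x 0‖ + ‖x 1‖ + ‖y 0‖ + ‖y 1‖, ?_⟩
    have := norm_nonneg xh
    have := norm_nonneg yh
    have := norm_nonneg (x 0)
    have := norm_nonneg (x 1)
    have := norm_nonneg (y 0)
    have := norm_nonneg (y 1)
    rintro (_ | _ | n)
    · constructor <;> linarith
    · rw [zero_add]; constructor <;> linarith
    · constructor <;> linarith [hxb n, hyb n]
  · rintro ⟨xs, ys⟩ hp
    obtain ⟨ψ, hψ, hlim⟩ := hp.tendsto_subseq
    have hψt := hψ.tendsto_atTop
    have hxψ : Tendsto (fun j => x (ψ j)) atTop (𝓝 xs) := (continuous_fst.tendsto _).comp hlim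
    have hyψ : Tendsto (fun j => y (ψ j)) atTop (𝓝 ys) := (continuous_snd.tendsto _).comp hlim
    have hxψ' : Tendsto (fun j => x (ψ j + 1)) atTop (𝓝 xs) := by
      simpa using (hdx.comp hψt).add hxψ
    have hybψ : Tendsto (fun j => ybar (ψ j)) atTop (𝓝 ys) := by
      simpa using (hdy.comp hψt).add hyψ
    have hq : Tendsto (fun k => (σ k)⁻¹ • (ybar k - y k)) atTop (𝓝 0) :=
      tendsto_zero_inv_smul_apply (T := fun _ => 1) hσlb hσlbk (fun _ => le_rfl) hdy
    have hs := tendsto_zero_inv_smul_apply (T := M) (mul_pos hβ hσlb)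
      (fun k => mul_le_mul_of_nonneg_left (hσlbk k) hβ.le) hMC hdx
    have hh' : Continuous h' :=
      (LipschitzWith.of_dist_le_mul (K := L.toNNReal) fun u v => by
        rw [dist_eq_norm, dist_eq_norm]
        exact (hLip u v).trans
          (mul_le_mul_of_nonneg_right (Real.le_coe_toNNReal L) (norm_nonneg _))).continuous
    have hev : ∀ᶠ j in atTop, 1 ≤ ψ j := hψt.eventually_ge_atTop 1
    have hF : ∀ v, fs v ≠ ⊤ → fs ys ≤ (((fs v).toReal - ⟪K xs, v - ys⟫ : ℝ) : EReal) := by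
      intro v hv
      refine hflsc.le_of_tendsto hyψ (r := fun j => (fs v).toReal
        + ⟪(σ (ψ j))⁻¹ • (ybar (ψ j) - y (ψ j)), v - y (ψ j)⟫
        - ⟪K (x (ψ j)), v - y (ψ j)⟫) ?_ ?_
      · have h1 := (hq.comp hψt).inner (𝕜 := ℝ) ((tendsto_const_nhds (x := v)).sub hyψ)
        have h2 := (((K.continuous.tendsto xs).comp hxψ).inner (𝕜 := ℝ)
          ((tendsto_const_nhds (x := v)).sub hyψ))
        simpa using (h1.const_add (fs v).toReal).sub h2
      · filter_upwards [hev] with j hj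
        obtain ⟨n, hn⟩ := Nat.exists_eq_add_of_le' hj
        rw [hn, ← EReal.coe_toReal (hfprox n).1 (hfbot _), EReal.coe_le_coe_iff]
        have h1 := (hfprox n).2 v hv
        have hd : (σ (n + 1))⁻¹ • (ybar (n + 1) - y (n + 1)) = (σ n)⁻¹ • (y (n + 1) - y n) := by
          rw [hybar (n + 1) (by omega), add_sub_cancel_left, smul_smul, Nat.add_sub_cancel,
            hθ (n + 1) (by omega), Nat.add_sub_cancel]
          congr 1
          have := (hσpos (n + 1)).ne'
          field_simp
        rw [hd, real_inner_smul_left]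
        have h2 := mul_le_mul_of_nonneg_left h1 (inv_pos.2 (hσpos n)).le
        rw [inv_mul_cancel_left₀ (hσpos n).ne', mul_sub, inv_mul_cancel_left₀ (hσpos n).ne'] at h2
        linarith
    have hG : ∀ z, g z ≠ ⊤ → g xs ≤
        (((g z).toReal + ⟪K (z - xs), ys⟫ + ⟪h' xs, z - xs⟫ : ℝ) : EReal) := by
      intro z hz
      refine hglsc.le_of_tendsto hxψ' (r := fun j => (g z).toReal
        + ⟪(β * σ (ψ j))⁻¹ • M (ψ j) (x (ψ j + 1) - x (ψ j)), z - x (ψ j + 1)⟫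
        + ⟪K (z - x (ψ j + 1)), ybar (ψ j)⟫ + ⟪h' (x (ψ j)), z - x (ψ j + 1)⟫) ?_ ?_
      · have hzx := (tendsto_const_nhds (x := z)).sub hxψ'
        have h1 := (hs.comp hψt).inner (𝕜 := ℝ) hzx
        have h2 := ((K.continuous.tendsto _).comp hzx).inner (𝕜 := ℝ) hybψ
        have h3 := ((hh'.tendsto xs).comp hxψ).inner (𝕜 := ℝ) hzx
        simpa using ((h1.const_add (g z).toReal).add h2).add h3
      · filter_upwards [hev] with j hj
        obtain ⟨hne, hle⟩ := hgprox _ hj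
        have hpos : 0 < β * σ (ψ j) := mul_pos hβ (hσpos _)
        rw [← EReal.coe_toReal hne (hgbot _), EReal.coe_le_coe_iff, real_inner_smul_left]
        have h2 := mul_le_mul_of_nonneg_left (hle z hz) (inv_pos.2 hpos).le
        rw [inv_mul_cancel_left₀ hpos.ne', mul_add, mul_add, inv_mul_cancel_left₀ hpos.ne',
          inv_mul_cancel_left₀ hpos.ne'] at h2
        linarith
    refine (isSaddlePoint_iff hgbot hgtop hfbot hftop).2
      ⟨(EReal.ne_top_and_toReal_le (hgbot xs) (hG xh hgxh)).1,
        (EReal.ne_top_and_toReal_le (hfbot ys) (hF yh hfyh)).1, fun z hz => ?_, fun v hv => ?_⟩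
    · have h1 := (EReal.ne_top_and_toReal_le (hgbot xs) (hG z hz)).2
      have h2 := hhconv.add_inner_gradient_le (hgrad xs) (v := z)
      rw [map_sub, inner_sub_left] at h1
      dsimp only
      linarith
    · have h1 := (EReal.ne_top_and_toReal_le (hfbot ys) (hF v hv)).2
      rw [inner_sub_right] at h1
      dsimp only
      linarith
end

section
/- (Proximal calculus for low-rank perturbed metrics.) Let σ > 0, B₀ a self-adjoint positive definite operator on ℝⁿ with B₀ ⪰ σ·Id, U₁ ∈ ℝ^{n×r₁} and U₂ ∈ ℝ^{n×r₂} of full column ranks r₁ and r₂, and suppose B := B₀ + U₁U₁ᵀ − U₂U₂ᵀ satisfies B ⪰ σ·Id. Set B₁ := B₀ + U₁U₁ᵀ. Let g : ℝⁿ → ℝ ∪ {+∞} be proper, lower semicontinuous and convex, and fix x ∈ ℝⁿ. Define 𝓛 = (𝓛₁, 𝓛₂) : ℝ^{r₁+r₂} → ℝ^{r₁+r₂} by 𝓛₁(α₁, α₂) := U₁ᵀ( x + B₁^{−1}U₂α₂ − prox^{B₀}_g( x + B₁^{−1}U₂α₂ − B₀^{−1}U₁α₁ ) ) + α₁ and 𝓛₂(α₁,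 α₂) := U₂ᵀ( x − prox^{B₀}_g( x + B₁^{−1}U₂α₂ − B₀^{−1}U₁α₁ ) ) + α₂. Then 𝓛 is Lipschitz continuous, has a unique zero α* = (α₁*, α₂*), and prox^{B}_g(x) = prox^{B₀}_g( x + B₁^{−1}U₂α₂* − B₀^{−1}U₁α₁* ). -/
open scoped RealInnerProductSpace

section Prox

open Topology Filter

variable {E : Type*} [NormedAddCommGroup E] [InnerProductSpace ℝ E]

/-- `s` is a subgradient of the extended-real-valued function `g` at `p`. -/
def IsSubgradientAt (g : E → EReal) (s p : E) : Prop :=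
  ∀ z, g p + ((⟪s, z - p⟫ : ℝ) : EReal) ≤ g z

/-- `p` minimizes `z ↦ g z + ½ ⟪M (z - w), z - w⟫`. -/
def IsProxAt (M : E →L[ℝ] E) (g : E → EReal) (w p : E) : Prop :=
  ∀ z, g p + ((1 / 2 * ⟪M (p - w), p - w⟫ : ℝ) : EReal)
    ≤ g z + ((1 / 2 * ⟪M (z - w), z - w⟫ : ℝ) : EReal)

variable {M : E →L[ℝ] E} {g : E → EReal}

theorem IsProxAt.ne_top {w p : E} (h : IsProxAt M g w p) (hgtop : ∃ z, g z ≠ ⊤) :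
    g p ≠ ⊤ := by
  obtain ⟨z, hz⟩ := hgtop
  intro hp
  have h1 := h z
  rw [hp, EReal.top_add_coe, top_le_iff] at h1
  exact EReal.add_ne_top hz (EReal.coe_ne_top _) h1

theorem inner_map_add_smul_self (hM : ∀ u v : E, ⟪M u, v⟫ = ⟪u, M v⟫) (u v : E) (t : ℝ) :
    ⟪M (u + t • v), u + t • v⟫ = ⟪M u, u⟫ + 2 * t * ⟪M u, v⟫ + t ^ 2 * ⟪M v, v⟫ := by
  have h : ⟪M v, u⟫ = ⟪M u, v⟫ := by rw [hM, real_inner_comm]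
  simp only [map_add, map_smul, inner_add_left, inner_add_right, real_inner_smul_left,
    real_inner_smul_right, h]
  ring

theorem IsProxAt.isSubgradientAt (hM : ∀ u v : E, ⟪M u, v⟫ = ⟪u, M v⟫)
    (hgbot : ∀ z, g z ≠ ⊥) (hgtop : ∃ z, g z ≠ ⊤) (hg : ERealConvexOn g) {w p : E}
    (h : IsProxAt M g w p) : IsSubgradientAt g (M (w - p)) p := by
  intro z
  by_cases hz : g z = ⊤
  · rw [hz]; exact le_top
  have hp := h.ne_top hgtop
  lift g z to ℝ using ⟨hz, hgbot z⟩ with Gz hGz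
  lift g p to ℝ using ⟨hp, hgbot p⟩ with Gp hGp
  have key : ∀ t : ℝ, 0 < t → t ≤ 1 →
      0 ≤ Gz - Gp + ⟪M (p - w), z - p⟫ + t * (1 / 2 * ⟪M (z - p), z - p⟫) := by
    intro t ht0 ht1
    have h1 := hg (u := p) (v := z) (sub_nonneg.2 ht1) ht0.le (sub_add_cancel 1 t)
    have h2 := h ((1 - t) • p + t • z)
    have e : (1 - t) • p + t • z - w = (p - w) + t • (z - p) := by module
    rw [e, inner_map_add_smul_self hM] at h2
    rw [← hGz, ← hGp] at h1
    rw [← hGp] at h2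
    have h3 := h2.trans (add_le_add_left h1 _)
    norm_cast at h3
    have h4 : 0 ≤ t * (Gz - Gp + ⟪M (p - w), z - p⟫ + t * (1 / 2 * ⟪M (z - p), z - p⟫)) := by
      nlinarith
    exact nonneg_of_mul_nonneg_right h4 ht0
  have hlim : Tendsto (fun t : ℝ => Gz - Gp + ⟪M (p - w), z - p⟫
      + t * (1 / 2 * ⟪M (z - p), z - p⟫)) (𝓝[>] 0)
      (𝓝 (Gz - Gp + ⟪M (p - w), z - p⟫ + 0 * (1 / 2 * ⟪M (z - p), z - p⟫))) :=
    (Continuous.tendsto (by fun_prop) 0).mono_left nhdsWithin_le_nhds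
  have h0 := ge_of_tendsto hlim (by
    filter_upwards [Ioc_mem_nhdsGT (zero_lt_one' ℝ)] with t ht using key t ht.1 ht.2)
  have e : ⟪M (w - p), z - p⟫ = -⟪M (p - w), z - p⟫ := by
    rw [← inner_neg_left, ← map_neg, neg_sub]
  rw [e]
  norm_cast
  linarith

theorem IsSubgradientAt.isProxAt (hM : ∀ u v : E, ⟪M u, v⟫ = ⟪u, M v⟫)
    (hMnonneg : ∀ z, 0 ≤ ⟪M z, z⟫) {w p : E} (h : IsSubgradientAt g (M (w - p)) p) :
    IsProxAt M g w p := by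
  intro z
  refine le_trans ?_ (add_le_add_left (h z) _)
  rw [add_assoc]
  refine add_le_add_right ?_ _
  norm_cast
  have h1 := inner_map_add_smul_self hM (p - w) (z - p) 1
  have e : p - w + (1 : ℝ) • (z - p) = z - w := by module
  have e' : ⟪M (w - p), z - p⟫ = -⟪M (p - w), z - p⟫ := by
    rw [← inner_neg_left, ← map_neg, neg_sub]
  rw [e] at h1
  rw [h1, e']
  linarith [hMnonneg (z - p)]

theorem IsSubgradientAt.inner_sub_nonneg {s s' p p' : E} (hgbot : ∀ z, g z ≠ ⊥)
    (hp : g p ≠ ⊤) (hp' : g p' ≠ ⊤)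
    (h : IsSubgradientAt g s p) (h' : IsSubgradientAt g s' p') :
    0 ≤ ⟪s - s', p - p'⟫ := by
  have h1 := h p'
  have h2 := h' p
  lift g p to ℝ using ⟨hp, hgbot p⟩ with Gp
  lift g p' to ℝ using ⟨hp', hgbot p'⟩ with Gp'
  norm_cast at h1 h2
  rw [← neg_sub p p', inner_neg_right] at h1
  rw [inner_sub_left]
  linarith

/-- Proximal points in a metric `M ⪰ σ·Id` depend Lipschitz-continuously on the base point. -/
theorem norm_sub_le_of_isSubgradientAt {σ : ℝ} (hσ : 0 < σ)
    (hMpd : ∀ z, σ * ‖z‖ ^ 2 ≤ ⟪M z, z⟫) (hgbot : ∀ z, g z ≠ ⊥) {w w' p p' : E}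
    (hp : g p ≠ ⊤) (hp' : g p' ≠ ⊤) (h : IsSubgradientAt g (M (w - p)) p)
    (h' : IsSubgradientAt g (M (w' - p')) p') :
    ‖p - p'‖ ≤ ‖M‖ / σ * ‖w - w'‖ := by
  have h1 := h.inner_sub_nonneg hgbot hp hp' h'
  have e : M (w - p) - M (w' - p') = M (w - w') - M (p - p') := by
    simp only [map_sub]; abel
  rw [e, inner_sub_left] at h1
  have h2 := hMpd (p - p')
  have h3 : ⟪M (w - w'), p - p'⟫ ≤ ‖M‖ * ‖w - w'‖ * ‖p - p'‖ :=
    (real_inner_le_norm _ _).trans (by gcongr; exact M.le_opNorm _)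
  rw [div_mul_eq_mul_div, le_div_iff₀ hσ]
  rcases (norm_nonneg (p - p')).eq_or_lt with h0 | h0
  · rw [← h0, zero_mul]; positivity
  · exact le_of_mul_le_mul_right (by nlinarith) h0

/-- A lower semicontinuous function, nowhere `⊥`, with a subgradient somewhere admits proximal points
in every metric `M ⪰ σ·Id`. -/
theorem exists_isProxAt [ProperSpace E] {σ : ℝ} (hσ : 0 < σ)
    (hMpd : ∀ z, σ * ‖z‖ ^ 2 ≤ ⟪M z, z⟫) (hgbot : ∀ z, g z ≠ ⊥)
    (hglsc : LowerSemicontinuous g) {s p : E} (hs : IsSubgradientAt g s p)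
    (x : E) : ∃ q, IsProxAt M g x q := by
  set f : E → EReal := fun z => g z + ((1 / 2 * ⟪M (z - x), z - x⟫ : ℝ) : EReal) with hf
  have hflsc : LowerSemicontinuous f := by
    refine hglsc.add' (Continuous.lowerSemicontinuous ?_) fun z => ?_
    · exact continuous_coe_real_ereal.comp (by fun_prop)
    · exact EReal.continuousAt_add (Or.inr (EReal.coe_ne_bot _)) (Or.inl (hgbot z))
  set C : ℝ := |⟪s, x - p⟫ - 1 / 2 * ⟪M (p - x), p - x⟫| with hC
  set R : ℝ := 1 + 2 / σ * (‖s‖ + C) + ‖p - x‖ with hR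
  have hpR : p ∈ Metric.closedBall x R := by
    rw [mem_closedBall_iff_norm, hR]
    have : 0 ≤ 2 / σ * (‖s‖ + C) := by positivity
    linarith
  obtain ⟨q, -, hq⟩ := (hflsc.lowerSemicontinuousOn _).exists_isMinOn ⟨p, hpR⟩
    (isCompact_closedBall x R)
  refine ⟨q, fun z => ?_⟩
  by_cases hz : z ∈ Metric.closedBall x R
  · exact hq hz
  refine (hq hpR).trans (le_trans ?_ (add_le_add_left (hs z) _))
  rw [add_assoc]
  refine add_le_add_right ?_ _
  norm_cast
  rw [mem_closedBall_iff_norm, not_le] at hz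
  have h1 : 1 ≤ ‖z - x‖ := by
    have : 0 ≤ 2 / σ * (‖s‖ + C) := by positivity
    linarith [norm_nonneg (p - x)]
  have h2 : ‖s‖ + C ≤ σ / 2 * ‖z - x‖ := by
    have : 2 / σ * (‖s‖ + C) ≤ ‖z - x‖ := by linarith [norm_nonneg (p - x)]
    calc ‖s‖ + C = σ / 2 * (2 / σ * (‖s‖ + C)) := by field_simp
      _ ≤ _ := by gcongr
  have h3 : -(‖s‖ * ‖z - x‖) ≤ ⟪s, z - x⟫ :=
    (abs_le.1 (abs_real_inner_le_norm s (z - x))).1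
  have e : ⟪s, z - p⟫ = ⟪s, z - x⟫ + ⟪s, x - p⟫ := by
    rw [← inner_add_right, sub_add_sub_cancel]
  have h4 := neg_abs_le (⟪s, x - p⟫ - 1 / 2 * ⟪M (p - x), p - x⟫)
  have h5 : 0 ≤ C := abs_nonneg _
  have h6 := hMpd (z - x)
  have h7 : (‖s‖ + C) * ‖z - x‖ ≤ σ / 2 * ‖z - x‖ * ‖z - x‖ := by gcongr
  rw [e]
  nlinarith

end Prox

/-- **proximal calculus for low-rank perturbed metrics.**
Let `B = B₀ + U₁U₁ᵀ − U₂U₂ᵀ ⪰ σ·Id` with `B₀ ⪰ σ·Id`, `U₁, U₂` of full column rank,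
`B₁ = B₀ + U₁U₁ᵀ`, and let `p₀` be the prox of `g` in the metric `B₀`. Then the map
`𝓛(α₁, α₂) = (U₁ᵀ(x + B₁⁻¹U₂α₂ − p₀(x + B₁⁻¹U₂α₂ − B₀⁻¹U₁α₁)) + α₁,
U₂ᵀ(x − p₀(x + B₁⁻¹U₂α₂ − B₀⁻¹U₁α₁)) + α₂)` is Lipschitz continuous with a unique
zero `α*`, and `prox^B_g(x) = p₀(x + B₁⁻¹U₂α₂* − B₀⁻¹U₁α₁*)`. -/
theorem prox_lowrank_perturbed_metric
    {n r₁ r₂ : ℕ}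
    (σ : ℝ) (hσ : 0 < σ)
    (B₀ : EuclideanSpace ℝ (Fin n) →L[ℝ] EuclideanSpace ℝ (Fin n))
    (hB₀sa : ∀ u v : EuclideanSpace ℝ (Fin n), ⟪B₀ u, v⟫ = ⟪u, B₀ v⟫)
    (hB₀pd : ∀ z : EuclideanSpace ℝ (Fin n), σ * ‖z‖ ^ 2 ≤ ⟪B₀ z, z⟫)
    (U₁ : EuclideanSpace ℝ (Fin r₁) →L[ℝ] EuclideanSpace ℝ (Fin n))
    (U₂ : EuclideanSpace ℝ (Fin r₂) →L[ℝ] EuclideanSpace ℝ (Fin n))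
    (hU₁ : Function.Injective U₁) (hU₂ : Function.Injective U₂)
    (B B₁ : EuclideanSpace ℝ (Fin n) →L[ℝ] EuclideanSpace ℝ (Fin n))
    (hB : B = B₀ + U₁.comp (ContinuousLinearMap.adjoint U₁)
        - U₂.comp (ContinuousLinearMap.adjoint U₂))
    (hBpd : ∀ z : EuclideanSpace ℝ (Fin n), σ * ‖z‖ ^ 2 ≤ ⟪B z, z⟫)
    (hB₁ : B₁ = B₀ + U₁.comp (ContinuousLinearMap.adjoint U₁))
    (B₀inv B₁inv : EuclideanSpace ℝ (Fin n) →L[ℝ] EuclideanSpace ℝ (Fin n))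
    (hB₀inv1 : B₀.comp B₀inv = ContinuousLinearMap.id ℝ (EuclideanSpace ℝ (Fin n)))
    (hB₀inv2 : B₀inv.comp B₀ = ContinuousLinearMap.id ℝ (EuclideanSpace ℝ (Fin n)))
    (hB₁inv1 : B₁.comp B₁inv = ContinuousLinearMap.id ℝ (EuclideanSpace ℝ (Fin n)))
    (hB₁inv2 : B₁inv.comp B₁ = ContinuousLinearMap.id ℝ (EuclideanSpace ℝ (Fin n)))
    (g : EuclideanSpace ℝ (Fin n) → EReal)
    (hgbot : ∀ z, g z ≠ ⊥) (hgtop : ∃ z, g z ≠ ⊤)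
    (hglsc : LowerSemicontinuous g) (hgconv : ERealConvexOn g)
    -- `p₀ w = prox^{B₀}_g(w)` for every `w`
    (p₀ : EuclideanSpace ℝ (Fin n) → EuclideanSpace ℝ (Fin n))
    (hp₀ : ∀ w z : EuclideanSpace ℝ (Fin n),
      g (p₀ w) + ((1 / 2 * ⟪B₀ (p₀ w - w), p₀ w - w⟫ : ℝ) : EReal)
        ≤ g z + ((1 / 2 * ⟪B₀ (z - w), z - w⟫ : ℝ) : EReal))
    (x : EuclideanSpace ℝ (Fin n))
    (𝓛 : EuclideanSpace ℝ (Fin r₁) × EuclideanSpace ℝ (Fin r₂) →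
      EuclideanSpace ℝ (Fin r₁) × EuclideanSpace ℝ (Fin r₂))
    (h𝓛 : ∀ a : EuclideanSpace ℝ (Fin r₁) × EuclideanSpace ℝ (Fin r₂),
      𝓛 a =
        ((ContinuousLinearMap.adjoint U₁)
            (x + B₁inv (U₂ a.2) - p₀ (x + B₁inv (U₂ a.2) - B₀inv (U₁ a.1))) + a.1,
         (ContinuousLinearMap.adjoint U₂)
            (x - p₀ (x + B₁inv (U₂ a.2) - B₀inv (U₁ a.1))) + a.2)) :
    (∃ c : NNReal, LipschitzWith c 𝓛) ∧
    (∃! a : EuclideanSpace ℝ (Fin r₁) × EuclideanSpace ℝ (Fin r₂), 𝓛 a = 0) ∧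
    ∀ a : EuclideanSpace ℝ (Fin r₁) × EuclideanSpace ℝ (Fin r₂), 𝓛 a = 0 →
      ∀ z : EuclideanSpace ℝ (Fin n),
        g (p₀ (x + B₁inv (U₂ a.2) - B₀inv (U₁ a.1)))
            + ((1 / 2 * ⟪B (p₀ (x + B₁inv (U₂ a.2) - B₀inv (U₁ a.1)) - x),
                p₀ (x + B₁inv (U₂ a.2) - B₀inv (U₁ a.1)) - x⟫ : ℝ) : EReal)
          ≤ g z + ((1 / 2 * ⟪B (z - x), z - x⟫ : ℝ) : EReal) := by
  have hBsa : ∀ u v : EuclideanSpace ℝ (Fin n), ⟪B u, v⟫ = ⟪u, B v⟫ := by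
    have hsa {r : ℕ} (U : EuclideanSpace ℝ (Fin r) →L[ℝ] EuclideanSpace ℝ (Fin n))
        (u v : EuclideanSpace ℝ (Fin n)) :
        ⟪U (ContinuousLinearMap.adjoint U u), v⟫ = ⟪u, U (ContinuousLinearMap.adjoint U v)⟫ := by
      rw [← ContinuousLinearMap.adjoint_inner_right, ContinuousLinearMap.adjoint_inner_left]
    intro u v
    simp only [hB, sub_apply, add_apply, ContinuousLinearMap.comp_apply, inner_sub_left,
      inner_add_left, inner_sub_right, inner_add_right, hB₀sa, hsa]
  have hBnonneg : ∀ z : EuclideanSpace ℝ (Fin n), 0 ≤ ⟪B z, z⟫ := fun z =>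
    (by positivity : 0 ≤ σ * ‖z‖ ^ 2).trans (hBpd z)
  have hB₀nonneg : ∀ z : EuclideanSpace ℝ (Fin n), 0 ≤ ⟪B₀ z, z⟫ := fun z =>
    (by positivity : 0 ≤ σ * ‖z‖ ^ 2).trans (hB₀pd z)
  have hprox : ∀ w, IsProxAt B₀ g w (p₀ w) := hp₀
  have hfin : ∀ w, g (p₀ w) ≠ ⊤ := fun w => (hprox w).ne_top hgtop
  have hsub : ∀ w, IsSubgradientAt g (B₀ (w - p₀ w)) (p₀ w) := fun w =>
    (hprox w).isSubgradientAt hB₀sa hgbot hgtop hgconv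
  have hi₀ : ∀ z, B₀ (B₀inv z) = z := fun z => DFunLike.congr_fun hB₀inv1 z
  have hi₁ : ∀ z, B₀ (B₁inv z) + U₁ (ContinuousLinearMap.adjoint U₁ (B₁inv z)) = z := fun z => by
    simpa [hB₁] using DFunLike.congr_fun hB₁inv1 z
  have hBapp : ∀ z, B z = B₀ z + U₁ (ContinuousLinearMap.adjoint U₁ z)
      - U₂ (ContinuousLinearMap.adjoint U₂ z) := fun z => by simp [hB]
  -- the residual in the metric `B₀` at the shifted point is the residual in the metric `B`
  have hres : ∀ (a₁ : EuclideanSpace ℝ (Fin r₁)) (a₂ : EuclideanSpace ℝ (Fin r₂))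
      (q : EuclideanSpace ℝ (Fin n)), a₂ = ContinuousLinearMap.adjoint U₂ (q - x) →
      a₁ = ContinuousLinearMap.adjoint U₁ (q - x - B₁inv (U₂ a₂)) →
      B₀ (x + B₁inv (U₂ a₂) - B₀inv (U₁ a₁) - q) = B (x - q) := by
    intro a₁ a₂ q h₂ h₁
    have e₁ : U₁ a₁ = U₁ (ContinuousLinearMap.adjoint U₁ (q - x))
        - U₁ (ContinuousLinearMap.adjoint U₁ (B₁inv (U₂ a₂))) := by
      rw [h₁, map_sub, map_sub]
    have e₂ : U₂ a₂ = U₂ (ContinuousLinearMap.adjoint U₂ (q - x)) := by rw [h₂]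
    have e₃ := hi₁ (U₂ a₂)
    have e₄ : B₀ (x + B₁inv (U₂ a₂) - B₀inv (U₁ a₁) - q)
        = B₀ x + B₀ (B₁inv (U₂ a₂)) - U₁ a₁ - B₀ q := by
      simp only [map_sub, map_add, hi₀]
    rw [e₄, e₁, eq_sub_of_add_eq e₃, e₂, hBapp]
    simp only [map_sub]
    abel
  have hzero : ∀ a : EuclideanSpace ℝ (Fin r₁) × EuclideanSpace ℝ (Fin r₂), 𝓛 a = 0 ↔
      a.2 = ContinuousLinearMap.adjoint U₂
        (p₀ (x + B₁inv (U₂ a.2) - B₀inv (U₁ a.1)) - x) ∧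
      a.1 = ContinuousLinearMap.adjoint U₁
        (p₀ (x + B₁inv (U₂ a.2) - B₀inv (U₁ a.1)) - x - B₁inv (U₂ a.2)) := by
    intro a
    rw [h𝓛, Prod.mk_eq_zero, and_comm, add_eq_zero_iff_neg_eq, add_eq_zero_iff_neg_eq,
      ← map_neg, ← map_neg, neg_sub, neg_sub, sub_sub, eq_comm, eq_comm (b := a.1)]
  have hsubB : ∀ a : EuclideanSpace ℝ (Fin r₁) × EuclideanSpace ℝ (Fin r₂), 𝓛 a = 0 →
      IsSubgradientAt g (B (x - p₀ (x + B₁inv (U₂ a.2) - B₀inv (U₁ a.1))))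
        (p₀ (x + B₁inv (U₂ a.2) - B₀inv (U₁ a.1))) := by
    intro a ha
    obtain ⟨h₂, h₁⟩ := (hzero a).1 ha
    rw [← hres a.1 a.2 _ h₂ h₁]
    exact hsub _
  refine ⟨?_, ?_, fun a ha => (hsubB a ha).isProxAt hBsa hBnonneg⟩
  · have hpl : LipschitzWith (‖B₀‖ / σ).toNNReal p₀ := by
      refine LipschitzWith.of_dist_le_mul fun w w' => ?_
      rw [dist_eq_norm, dist_eq_norm, Real.coe_toNNReal _ (by positivity)]
      exact norm_sub_le_of_isSubgradientAt hσ hB₀pd hgbot (hfin w) (hfin w') (hsub w) (hsub w')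
    have hS := (B₁inv.comp (U₂.comp (ContinuousLinearMap.snd ℝ (EuclideanSpace ℝ (Fin r₁))
      (EuclideanSpace ℝ (Fin r₂))))).lipschitz
    have hT := (B₀inv.comp (U₁.comp (ContinuousLinearMap.fst ℝ (EuclideanSpace ℝ (Fin r₁))
      (EuclideanSpace ℝ (Fin r₂))))).lipschitz
    have hx := LipschitzWith.const (α := EuclideanSpace ℝ (Fin r₁) × EuclideanSpace ℝ (Fin r₂)) x
    have hp := hpl.comp ((hx.add hS).sub hT)
    have h₁ := ((ContinuousLinearMap.adjoint U₁).lipschitz.comp ((hx.add hS).sub hp)).add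
      LipschitzWith.prod_fst
    have h₂ := ((ContinuousLinearMap.adjoint U₂).lipschitz.comp (hx.sub hp)).add
      LipschitzWith.prod_snd
    exact ⟨_, (funext h𝓛 : 𝓛 = _) ▸ h₁.prodMk h₂⟩
  · obtain ⟨q, hq⟩ := exists_isProxAt hσ hBpd hgbot hglsc (hsub x) x
    have hqtop := hq.ne_top hgtop
    have hqsub := hq.isSubgradientAt hBsa hgbot hgtop hgconv
    set b₂ := ContinuousLinearMap.adjoint U₂ (q - x) with hb₂
    set b₁ := ContinuousLinearMap.adjoint U₁ (q - x - B₁inv (U₂ b₂)) with hb₁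
    have hqp : p₀ (x + B₁inv (U₂ b₂) - B₀inv (U₁ b₁)) = q := by
      have h := norm_sub_le_of_isSubgradientAt hσ hB₀pd hgbot (hfin _) hqtop
        (hsub (x + B₁inv (U₂ b₂) - B₀inv (U₁ b₁)))
        (by rw [hres b₁ b₂ q hb₂ hb₁]; exact hqsub)
      rwa [sub_self, norm_zero, mul_zero, norm_le_zero_iff, sub_eq_zero] at h
    refine ⟨(b₁, b₂), (hzero _).2 ?_, fun a ha => ?_⟩
    · simp only [hqp]
      exact ⟨hb₂, hb₁⟩
    · have hpq := norm_sub_le_of_isSubgradientAt hσ hBpd hgbot (hfin _) hqtop (hsubB a ha) hqsub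
      rw [sub_self, norm_zero, mul_zero, norm_le_zero_iff, sub_eq_zero] at hpq
      obtain ⟨h₂, h₁⟩ := (hzero a).1 ha
      rw [hpq] at h₁ h₂
      have h₂' : a.2 = b₂ := h₂
      rw [h₂'] at h₁
      exact Prod.ext h₁ h₂'
end
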